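/- arXiv:1805.12017 — 2 statements merged into one kernel-verified Lean document; each statement's English description precedes it below -/
import Mathlib

section
/- Let p : ℝ^L → ℝ be a probability density that is bounded and continuous, with a bounded and continuous gradient, and with finite first moment ∫‖x‖ p(x) dx < ∞. For σ > 0 let φ_σ(u) = (2πσ²)^{−L/2} exp(−‖u‖²/(2σ²)) be the density of the Gaussian N(0, σ² I_L) on ℝ^L, let p_σ(z) = ∫_{ℝ^L} φ_σ(z − x) p(x) dx, and let m_σ(z) = (∫_{ℝ^L} x φ_σ(z − x) p(x) dx) / p_σ(z) be the Bayes-optimal denoiser (the minimizer of the denoising autoencoder objective E_{x∼p, ν∼N(0,σ²I_L)} ‖r(x+ν) − x‖²). Then at every point x ∈ ℝ^L with p(x) > 0, the residual satisfies m_σ(x) − x = σ² ∇_x log p(x) + o(σ²) as σ → 0. -/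
open MeasureTheory Filter Asymptotics
open scoped Topology

lemma hasFDerivAt_exp_neg_half_sq_norm {E : Type*} [NormedAddCommGroup E]
    [InnerProductSpace ℝ E] (u : E) :
    HasFDerivAt (fun u : E => Real.exp (-‖u‖ ^ 2 / 2))
      (-Real.exp (-‖u‖ ^ 2 / 2) • innerSL ℝ u) u := by
  have h := (((hasStrictFDerivAt_norm_sq u).hasFDerivAt.neg).mul_const (1 / 2 : ℝ)).exp
  refine (h.congr_fderiv ?_).congr_of_eventuallyEq (Eventually.of_forall fun v => ?_)
  · ext v
    simp [div_eq_mul_inv]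
  · simp [div_eq_mul_inv]

lemma abs_sub_le_of_norm_gradient_le {E : Type*} [NormedAddCommGroup E]
    [InnerProductSpace ℝ E] [CompleteSpace E] {p : E → ℝ} (hp : Differentiable ℝ p) {C : ℝ}
    (hC : ∀ x, ‖gradient p x‖ ≤ C) (x y : E) : |p y - p x| ≤ C * ‖y - x‖ :=
  Convex.norm_image_sub_le_of_norm_fderiv_le (𝕜 := ℝ) (fun z _ => hp z)
    (fun z _ => by simpa [gradient] using hC z) convex_univ (Set.mem_univ x) (Set.mem_univ y)

lemma gradient_log {E : Type*} [NormedAddCommGroup E] [InnerProductSpace ℝ E] [CompleteSpace E]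
    {p : E → ℝ} {x : E} (hp : DifferentiableAt ℝ p x) (hx : p x ≠ 0) :
    gradient (fun y => Real.log (p y)) x = (p x)⁻¹ • gradient p x := by
  simp [gradient, fderiv.log hp hx]

section GaussianWeight

variable {E : Type*} [NormedAddCommGroup E] [InnerProductSpace ℝ E] [FiniteDimensional ℝ E]
  [MeasurableSpace E] [BorelSpace E]

lemma integral_exp_neg_half_sq_norm :
    ∫ u : E, Real.exp (-‖u‖ ^ 2 / 2) = (2 * Real.pi) ^ (Module.finrank ℝ E / 2 : ℝ) := by
  have h := GaussianFourier.integral_rexp_neg_mul_sq_norm (V := E) (b := 1 / 2) (by norm_num)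
  rw [show Real.pi / (1 / 2) = 2 * Real.pi by ring] at h
  rw [← h]
  congr 1 with u
  congr 1
  ring

lemma integral_exp_neg_half_sq_norm_pos : 0 < ∫ u : E, Real.exp (-‖u‖ ^ 2 / 2) := by
  rw [integral_exp_neg_half_sq_norm]
  positivity

lemma integrable_exp_neg_mul_sq_norm {b : ℝ} (hb : 0 < b) :
    Integrable fun u : E => Real.exp (-b * ‖u‖ ^ 2) := by
  refine Integrable.of_integral_ne_zero ?_
  rw [GaussianFourier.integral_rexp_neg_mul_sq_norm hb]
  positivity

lemma integrable_exp_neg_half_sq_norm : Integrable fun u : E => Real.exp (-‖u‖ ^ 2 / 2) := by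
  refine (integrable_exp_neg_mul_sq_norm (E := E) (b := 1 / 2) (by norm_num)).congr
    (ae_of_all _ fun u => ?_)
  dsimp only
  congr 1
  ring

lemma integrable_exp_neg_half_sq_norm_mul_sq_norm :
    Integrable fun u : E => Real.exp (-‖u‖ ^ 2 / 2) * ‖u‖ ^ 2 := by
  refine ((integrable_exp_neg_mul_sq_norm (E := E) (b := 1 / 4) (by norm_num)).const_mul 4).mono'
    (by fun_prop) (ae_of_all _ fun u => ?_)
  rw [Real.norm_of_nonneg (by positivity)]
  have hsplit : Real.exp (-‖u‖ ^ 2 / 2) =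
      Real.exp (-(1 / 4) * ‖u‖ ^ 2) * Real.exp (-(‖u‖ ^ 2 / 4)) := by
    rw [← Real.exp_add]
    congr 1
    ring
  have hle : ‖u‖ ^ 2 / 4 * Real.exp (-(‖u‖ ^ 2 / 4)) ≤ 1 := by
    rw [Real.exp_neg, ← div_eq_mul_inv, div_le_one (Real.exp_pos _)]
    linarith [Real.add_one_le_exp (‖u‖ ^ 2 / 4)]
  rw [hsplit]
  nlinarith [Real.exp_pos (-(1 / 4) * ‖u‖ ^ 2)]

lemma integrable_exp_neg_half_sq_norm_mul_norm :
    Integrable fun u : E => Real.exp (-‖u‖ ^ 2 / 2) * ‖u‖ := by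
  refine ((integrable_exp_neg_half_sq_norm (E := E)).add
    integrable_exp_neg_half_sq_norm_mul_sq_norm).mono' (by fun_prop) (ae_of_all _ fun u => ?_)
  rw [Real.norm_of_nonneg (by positivity)]
  simp only [Pi.add_apply]
  nlinarith [Real.exp_pos (-‖u‖ ^ 2 / 2), sq_nonneg (‖u‖ - 1), norm_nonneg u,
    mul_nonneg (Real.exp_pos (-‖u‖ ^ 2 / 2)).le (sq_nonneg (‖u‖ - 1)),
    mul_nonneg (Real.exp_pos (-‖u‖ ^ 2 / 2)).le (norm_nonneg u)]

lemma integral_exp_neg_half_sq_norm_smul_self :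
    ∫ u : E, Real.exp (-‖u‖ ^ 2 / 2) • u = 0 := by
  have h := integral_neg_eq_self (fun u : E => Real.exp (-‖u‖ ^ 2 / 2) • u) volume
  simp only [norm_neg, smul_neg, integral_neg] at h
  have h2 : (2 : ℝ) • ∫ u : E, Real.exp (-‖u‖ ^ 2 / 2) • u = 0 := by
    rw [two_smul]
    nth_rw 1 [← h]
    exact neg_add_cancel _
  exact (smul_eq_zero.mp h2).resolve_left two_ne_zero

lemma integrable_exp_neg_half_sq_norm_mul_inner_smul (a : E) :
    Integrable fun u : E => (Real.exp (-‖u‖ ^ 2 / 2) * inner ℝ a u) • u := by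
  refine (integrable_exp_neg_half_sq_norm_mul_sq_norm.const_mul ‖a‖).mono'
    (by fun_prop) (ae_of_all _ fun u => ?_)
  rw [norm_smul, norm_mul, Real.norm_of_nonneg (Real.exp_pos _).le]
  calc _ ≤ Real.exp (-‖u‖ ^ 2 / 2) * (‖a‖ * ‖u‖) * ‖u‖ := by
        gcongr
        exact norm_inner_le_norm a u
    _ = _ := by ring

lemma integral_exp_neg_half_sq_norm_mul_inner_smul (a : E) :
    ∫ u : E, (Real.exp (-‖u‖ ^ 2 / 2) * inner ℝ a u) • u =
      (∫ u : E, Real.exp (-‖u‖ ^ 2 / 2)) • a := by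
  refine ext_inner_left ℝ fun v => ?_
  rw [← integral_inner (integrable_exp_neg_half_sq_norm_mul_inner_smul a) v]
  have hfa : ∀ u : E, fderiv ℝ (fun u : E => (inner ℝ a u : ℝ)) u = innerSL ℝ a :=
    fun u => (innerSL ℝ a).hasFDerivAt.fderiv
  have hparts := integral_mul_fderiv_eq_neg_fderiv_mul_of_integrable (𝕜 := ℝ) (μ := volume)
    (f := fun u : E => inner ℝ a u) (g := fun u : E => Real.exp (-‖u‖ ^ 2 / 2)) (v := v)
    ?_ ?_ ?_ ?_ ?_
  · simp only [hfa, (hasFDerivAt_exp_neg_half_sq_norm _).fderiv, innerSL_apply_apply,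
      smul_apply, integral_const_mul, smul_eq_mul] at hparts
    rw [inner_smul_right, real_inner_comm a v, mul_comm, ← neg_inj, ← hparts, ← integral_neg]
    congr 1 with u
    rw [inner_smul_right, real_inner_comm u v]
    ring
  · simp only [hfa, innerSL_apply_apply]
    exact integrable_exp_neg_half_sq_norm.const_mul _
  · refine ((integrable_exp_neg_half_sq_norm_mul_inner_smul a).const_inner (-v)).congr
      (ae_of_all _ fun u => ?_)
    simp only [(hasFDerivAt_exp_neg_half_sq_norm _).fderiv, innerSL_apply_apply,
      smul_apply, smul_eq_mul, inner_smul_right, inner_neg_left, real_inner_comm u v]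
    ring
  · refine (integrable_exp_neg_half_sq_norm_mul_norm.const_mul ‖a‖).mono'
      (by fun_prop) (ae_of_all _ fun u => ?_)
    rw [norm_mul, Real.norm_of_nonneg (Real.exp_pos _).le]
    calc _ ≤ ‖a‖ * ‖u‖ * Real.exp (-‖u‖ ^ 2 / 2) := by
          gcongr
          exact norm_inner_le_norm a u
      _ = _ := by ring
  · exact fun u _ => (innerSL ℝ a).differentiableAt
  · exact fun u _ => (hasFDerivAt_exp_neg_half_sq_norm u).differentiableAt

lemma integral_gaussian_sub_smul {G : Type*} [NormedAddCommGroup G] [NormedSpace ℝ G]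
    {σ : ℝ} (hσ : 0 < σ) (x : E) (F : E → G) :
    ∫ y, ((2 * Real.pi * σ ^ 2) ^ (-(Module.finrank ℝ E : ℝ) / 2) *
        Real.exp (-‖x - y‖ ^ 2 / (2 * σ ^ 2))) • F y =
      ((2 * Real.pi) ^ (-(Module.finrank ℝ E : ℝ) / 2)) •
        ∫ u, Real.exp (-‖u‖ ^ 2 / 2) • F (x + σ • u) := by
  have hexp (u : E) : Real.exp (-‖u‖ ^ 2 / 2) • F (x + σ • u) =
      (fun y => Real.exp (-‖y‖ ^ 2 / (2 * σ ^ 2)) • F (x + y)) (σ • u) := by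
    simp only [norm_smul, Real.norm_of_nonneg hσ.le]
    congr 2
    field_simp
  rw [integral_congr_ae (ae_of_all _ hexp),
    Measure.integral_comp_smul volume
      (fun y => Real.exp (-‖y‖ ^ 2 / (2 * σ ^ 2)) • F (x + y)) σ,
    ← integral_add_left_eq_self _ x]
  simp only [mul_smul, sub_add_cancel_left, norm_neg]
  rw [integral_smul, smul_smul]
  congr 1
  rw [Real.mul_rpow (by positivity) (by positivity), abs_of_pos (by positivity),
    ← Real.rpow_natCast σ 2, ← Real.rpow_mul hσ.le, ← Real.rpow_natCast σ, ← Real.rpow_neg hσ.le]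
  congr 2
  push_cast
  ring

lemma tendsto_integral_gaussian_mul_comp {p : E → ℝ} (hp : Continuous p) {C : ℝ}
    (hC : ∀ x, ‖p x‖ ≤ C) (x : E) :
    Tendsto (fun σ : ℝ => ∫ u, Real.exp (-‖u‖ ^ 2 / 2) * p (x + σ • u)) (𝓝[>] 0)
      (𝓝 ((∫ u : E, Real.exp (-‖u‖ ^ 2 / 2)) * p x)) := by
  rw [← integral_mul_const]
  refine tendsto_integral_filter_of_dominated_convergence
    (fun u => Real.exp (-‖u‖ ^ 2 / 2) * C) (Eventually.of_forall fun σ => by fun_prop)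
    (Eventually.of_forall fun σ => ae_of_all _ fun u => ?_)
    (integrable_exp_neg_half_sq_norm.mul_const C) (ae_of_all _ fun u => ?_)
  · rw [norm_mul, Real.norm_of_nonneg (Real.exp_pos _).le]
    gcongr
    exact hC _
  · refine Tendsto.const_mul _ (tendsto_nhdsWithin_of_tendsto_nhds ?_)
    have h : Continuous fun σ : ℝ => p (x + σ • u) := by fun_prop
    simpa using h.tendsto 0

lemma tendsto_integral_gaussian_mul_slope_smul {p : E → ℝ} (hp : Differentiable ℝ p) {C : ℝ}
    (hC : ∀ x, ‖gradient p x‖ ≤ C) (x : E) :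
    Tendsto (fun σ : ℝ => ∫ u, (Real.exp (-‖u‖ ^ 2 / 2) * (σ⁻¹ * (p (x + σ • u) - p x))) • u)
      (𝓝[>] 0) (𝓝 ((∫ u : E, Real.exp (-‖u‖ ^ 2 / 2)) • gradient p x)) := by
  rw [← integral_exp_neg_half_sq_norm_mul_inner_smul]
  have hpc := hp.continuous
  refine tendsto_integral_filter_of_dominated_convergence
    (fun u => Real.exp (-‖u‖ ^ 2 / 2) * ‖u‖ ^ 2 * C) (Eventually.of_forall fun σ => by fun_prop)
    ?_ (integrable_exp_neg_half_sq_norm_mul_sq_norm.mul_const C) (ae_of_all _ fun u => ?_)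
  · filter_upwards [self_mem_nhdsWithin] with σ (hσ : 0 < σ)
    refine ae_of_all _ fun u => ?_
    have h := abs_sub_le_of_norm_gradient_le hp hC x (x + σ • u)
    rw [add_sub_cancel_left, norm_smul, Real.norm_of_nonneg hσ.le] at h
    rw [norm_smul, norm_mul, norm_mul, Real.norm_of_nonneg (Real.exp_pos _).le,
      Real.norm_of_nonneg (inv_pos.mpr hσ).le, Real.norm_eq_abs]
    calc _ ≤ Real.exp (-‖u‖ ^ 2 / 2) * (σ⁻¹ * (C * (σ * ‖u‖))) * ‖u‖ := by gcongr
      _ = _ := by field_simp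
  · have hline : HasDerivAt (fun σ : ℝ => p (x + σ • u)) (inner ℝ (gradient p x) u) 0 := by
      have h := (hp x).hasGradientAt.hasFDerivAt.hasLineDerivAt u
      simpa [HasLineDerivAt] using h
    have h := hline.tendsto_slope_zero_right
    simp only [zero_add, zero_smul, add_zero, smul_eq_mul] at h
    exact (h.const_mul _).smul_const u

end GaussianWeight

/-- **Proposition 1 (DAE residual estimates the score).**
If `p` is a bounded continuous probability density on `ℝ^L` with bounded continuous
gradient and finite first moment, `φ σ` is the Gaussian density `N(0, σ² I_L)`,
`psm σ` the Gaussian-smoothed density and `m σ` the Bayes-optimal denoiser, then at every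
point `x` with `p x > 0` the residual satisfies
`m σ x - x = σ² ∇ log p(x) + o(σ²)` as `σ → 0`. -/
theorem dae_residual_is_score_littleO (L : ℕ)
    (p : EuclideanSpace ℝ (Fin L) → ℝ)
    (hp_nonneg : ∀ x, 0 ≤ p x)
    (hp_prob : ∫ x, p x = 1)
    (hp_cont : Continuous p)
    (hp_bdd : ∃ C, ∀ x, p x ≤ C)
    (hp_diff : Differentiable ℝ p)
    (hgrad_cont : Continuous fun x => gradient p x)
    (hgrad_bdd : ∃ C, ∀ x, ‖gradient p x‖ ≤ C)
    (hmom : Integrable fun x => ‖x‖ * p x)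
    (φ : ℝ → EuclideanSpace ℝ (Fin L) → ℝ)
    (hφ : ∀ σ u, φ σ u =
      (2 * Real.pi * σ ^ 2) ^ (-(L : ℝ) / 2) * Real.exp (-‖u‖ ^ 2 / (2 * σ ^ 2)))
    (psm : ℝ → EuclideanSpace ℝ (Fin L) → ℝ)
    (hpsm : ∀ σ z, psm σ z = ∫ x, φ σ (z - x) * p x)
    (m : ℝ → EuclideanSpace ℝ (Fin L) → EuclideanSpace ℝ (Fin L))
    (hm : ∀ σ z, m σ z = (psm σ z)⁻¹ • ∫ x, (φ σ (z - x) * p x) • x)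
    (x : EuclideanSpace ℝ (Fin L)) (hx : 0 < p x) :
    (fun σ => m σ x - x - σ ^ 2 • gradient (fun y => Real.log (p y)) x)
      =o[𝓝[>] (0 : ℝ)] fun σ => σ ^ 2 := by
  obtain ⟨C, hC⟩ := hp_bdd
  obtain ⟨D, hD⟩ := hgrad_bdd
  have hC' : ∀ y, ‖p y‖ ≤ C := fun y => (Real.norm_of_nonneg (hp_nonneg y)).trans_le (hC y)
  have hp_int : Integrable p := Integrable.of_integral_ne_zero (by simp [hp_prob])
  have hsubst {G : Type} [NormedAddCommGroup G] [NormedSpace ℝ G] {σ : ℝ} (hσ : 0 < σ)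
      (F : EuclideanSpace ℝ (Fin L) → G) :
      ∫ y, φ σ (x - y) • F y = ((2 * Real.pi) ^ (-(L : ℝ) / 2)) •
        ∫ u, Real.exp (-‖u‖ ^ 2 / 2) • F (x + σ • u) := by
    simpa [hφ] using integral_gaussian_sub_smul hσ x F
  set c : ℝ := (2 * Real.pi) ^ (-(L : ℝ) / 2)
  have hc : 0 < c := by positivity
  set A : ℝ → ℝ := fun σ => ∫ u, Real.exp (-‖u‖ ^ 2 / 2) * p (x + σ • u)
  set B : ℝ → EuclideanSpace ℝ (Fin L) :=
    fun σ => ∫ u, (Real.exp (-‖u‖ ^ 2 / 2) * (σ⁻¹ * (p (x + σ • u) - p x))) • u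
  have hI := integral_exp_neg_half_sq_norm_pos (E := EuclideanSpace ℝ (Fin L))
  have hA := tendsto_integral_gaussian_mul_comp hp_cont hC' x
  have hB := tendsto_integral_gaussian_mul_slope_smul hp_diff hD x
  have hres : ∀ᶠ σ in 𝓝[>] (0 : ℝ), m σ x - x = σ ^ 2 • ((A σ)⁻¹ • B σ) := by
    filter_upwards [self_mem_nhdsWithin, hA.eventually_ne (mul_pos hI hx).ne']
      with σ (hσ : 0 < σ) (hAσ : A σ ≠ 0)
    have hps : psm σ x = c * A σ := by
      rw [hpsm]
      exact hsubst hσ p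
    have hps0 : psm σ x ≠ 0 := hps ▸ mul_ne_zero hc.ne' hAσ
    have hφ_cont : Continuous (φ σ) := by
      rw [funext (hφ σ)]
      fun_prop
    have hφ_le (u) : ‖φ σ u‖ ≤ (2 * Real.pi * σ ^ 2) ^ (-(L : ℝ) / 2) := by
      rw [hφ, Real.norm_of_nonneg (by positivity)]
      refine mul_le_of_le_one_right (by positivity) (Real.exp_le_one_iff.mpr ?_)
      rw [neg_div]
      exact neg_nonpos.mpr (by positivity)
    have hint : Integrable fun y => φ σ (x - y) * p y :=
      hp_int.bdd_mul (by fun_prop) (ae_of_all _ fun y => hφ_le (x - y))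
    have hpy : Integrable fun y => p y • y :=
      hmom.mono (by fun_prop) (ae_of_all _ fun y => by simp [norm_smul, mul_comm])
    have hint' : Integrable fun y => (φ σ (x - y) * p y) • y := by
      simp only [mul_smul]
      exact hpy.bdd_smul _ (by fun_prop) (ae_of_all _ fun y => hφ_le (x - y))
    have hnum : (∫ y, (φ σ (x - y) * p y) • y) - psm σ x • x = (c * σ ^ 2) • B σ := by
      rw [hpsm, ← integral_smul_const, ← integral_sub hint' (hint.smul_const x)]
      simp only [← smul_sub, mul_smul]
      rw [hsubst hσ fun y => p y • (y - x)]
      congr 1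
      have hg : Integrable fun u : EuclideanSpace ℝ (Fin L) => Real.exp (-‖u‖ ^ 2 / 2) • u :=
        integrable_exp_neg_half_sq_norm_mul_norm.mono' (by fun_prop)
          (ae_of_all _ fun u => by simp [norm_smul])
      have hgp : Integrable fun u : EuclideanSpace ℝ (Fin L) =>
          p (x + σ • u) • (Real.exp (-‖u‖ ^ 2 / 2) • u) :=
        hg.bdd_smul _ (by fun_prop) (ae_of_all _ fun u => hC' (x + σ • u))
      have hzero : ∫ u : EuclideanSpace ℝ (Fin L), p x • (Real.exp (-‖u‖ ^ 2 / 2) • u) = 0 := by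
        rw [integral_smul, integral_exp_neg_half_sq_norm_smul_self, smul_zero]
      have hBσ : σ • B σ = ∫ u, p (x + σ • u) • (Real.exp (-‖u‖ ^ 2 / 2) • u) := by
        rw [← sub_zero (∫ u, p (x + σ • u) • (Real.exp (-‖u‖ ^ 2 / 2) • u)),
          ← hzero, ← integral_sub hgp (hg.fun_smul (p x)), ← integral_smul]
        congr 1 with u : 1
        rw [← sub_smul, smul_smul, smul_smul]
        congr 1
        field_simp
      rw [pow_two, mul_smul, hBσ, ← integral_smul]
      congr 1 with u : 1
      rw [add_sub_cancel_left]
      module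
    have hx_eq : x = (psm σ x)⁻¹ • (psm σ x • x) := (inv_smul_smul₀ hps0 x).symm
    rw [hm]
    nth_rw 3 [hx_eq]
    rw [← smul_sub, hnum, hps, smul_smul, smul_smul]
    congr 1
    field_simp
  have hlim : Tendsto (fun σ => (A σ)⁻¹ • B σ - (p x)⁻¹ • gradient p x) (𝓝[>] 0) (𝓝 0) := by
    refine tendsto_sub_nhds_zero_iff.mpr ?_
    have h := (hA.inv₀ (mul_pos hI hx).ne').smul hB
    rwa [smul_smul, mul_inv, mul_right_comm, inv_mul_cancel₀ hI.ne', one_mul] at h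
  have ho := (isBigO_refl (fun σ : ℝ => σ ^ 2) (𝓝[>] 0)).smul_isLittleO
    ((isLittleO_one_iff ℝ).mpr hlim)
  refine ho.congr' ?_ (by simp)
  filter_upwards [hres] with σ hσ
  rw [hσ, gradient_log (hp_diff x) hx.ne', smul_sub]
end

section
/- Let r : ℝ^L → ℝ^L be three times continuously differentiable with globally bounded third-order partial derivatives, and fix x ∈ ℝ^L. For ν ∼ N(0, σ² I_L), as σ → 0, E_ν ‖r(x + ν) − x‖² = ‖r(x) − x‖² + σ² Σ_{l=1}^L [ (r_l(x) − x_l) Δ r_l(x) + ‖∇ r_l(x)‖² ] + O(σ³), where r_l denotes the l-th component of r, ∇ r_l its gradient, and Δ r_l = tr(∂² r_l / ∂x ∂x) its Laplacian. -/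
open MeasureTheory Filter Asymptotics
open scoped Topology BigOperators
open ProbabilityTheory

section Taylor

variable {E F : Type*} [NormedAddCommGroup E] [NormedSpace ℝ E]
  [NormedAddCommGroup F] [NormedSpace ℝ F]

lemma norm_le_mul_norm_sub_pow_succ_of_fderiv {g : E → F} {g' : E → E →L[ℝ] F} {x : E} {C : ℝ}
    {n : ℕ} (hC : 0 ≤ C) (hg : ∀ y, HasFDerivAt g (g' y) y) (hx : g x = 0)
    (hbound : ∀ y, ‖g' y‖ ≤ C * ‖y - x‖ ^ n) (y : E) :
    ‖g y‖ ≤ C * ‖y - x‖ ^ (n + 1) := by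
  have h := (convex_closedBall x ‖y - x‖).norm_image_sub_le_of_norm_hasFDerivWithin_le
    (f := g) (f' := g') (C := C * ‖y - x‖ ^ n) (x := x) (y := y)
    (fun z _ => (hg z).hasFDerivWithinAt)
    (fun z hz => (hbound z).trans (by
      rw [mem_closedBall_iff_norm] at hz
      gcongr))
    (by simp) (by simp [dist_eq_norm])
  rw [hx, sub_zero] at h
  rwa [pow_succ, ← mul_assoc]

lemma norm_second_order_taylor_remainder_le {f : E → F} (hf : ContDiff ℝ 3 f) {C : ℝ}
    (hC : ∀ y, ‖iteratedFDeriv ℝ 3 f y‖ ≤ C) (x v : E) :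
    ‖f (x + v) - f x - fderiv ℝ f x v - (1 / 2 : ℝ) • fderiv ℝ (fderiv ℝ f) x v v‖
      ≤ C * ‖v‖ ^ 3 := by
  have hC0 : 0 ≤ C := (norm_nonneg _).trans (hC x)
  have hf1 : ContDiff ℝ 2 (fderiv ℝ f) := hf.fderiv_right (by norm_num)
  have hf2 : ContDiff ℝ 1 (fderiv ℝ (fderiv ℝ f)) := hf1.fderiv_right (by norm_num)
  have hd0 (y : E) : HasFDerivAt f (fderiv ℝ f y) y :=
    (hf.differentiable (by norm_num) y).hasFDerivAt
  have hd1 (y : E) : HasFDerivAt (fderiv ℝ f) (fderiv ℝ (fderiv ℝ f) y) y :=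
    (hf1.differentiable (by norm_num) y).hasFDerivAt
  have hd2 (y : E) : HasFDerivAt (fderiv ℝ (fderiv ℝ f))
      (fderiv ℝ (fderiv ℝ (fderiv ℝ f)) y) y :=
    (hf2.differentiable (by norm_num) y).hasFDerivAt
  have hsymm : IsSymmSndFDerivAt ℝ f x := hf.contDiffAt.isSymmSndFDerivAt (by simp; norm_num)
  set A := fderiv ℝ f x with hA
  set B := fderiv ℝ (fderiv ℝ f) x with hB
  have h2 := norm_le_mul_norm_sub_pow_succ_of_fderiv
    (g := fun y => fderiv ℝ (fderiv ℝ f) y - B) (x := x) (n := 0) hC0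
    (fun y => (hd2 y).sub_const B) (by simp [hB]) (fun y => by
      have := hC y
      rw [← norm_iteratedFDeriv_fderiv, ← norm_iteratedFDeriv_fderiv,
        ← norm_iteratedFDeriv_fderiv, norm_iteratedFDeriv_zero] at this
      simpa using this)
  have h1 := norm_le_mul_norm_sub_pow_succ_of_fderiv
    (g := fun y => fderiv ℝ f y - A - B (y - x)) (x := x) (n := 1) hC0
    (fun y => ((hd1 y).sub_const A).sub
      (B.hasFDerivAt.comp y ((hasFDerivAt_id y).sub_const x)))
    (by simp [hA]) (fun y => by simpa using h2 y)
  have h0 := norm_le_mul_norm_sub_pow_succ_of_fderiv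
    (g := fun y => f y - f x - A (y - x) - (1 / 2 : ℝ) • B (y - x) (y - x)) (x := x)
    (g' := fun y => fderiv ℝ f y - A - B (y - x)) (n := 2) hC0
    (fun y => by
      have hy : HasFDerivAt (fun y => y - x) (ContinuousLinearMap.id ℝ E) y :=
        (hasFDerivAt_id y).sub_const x
      have hBy := (B.hasFDerivAt.comp y hy).clm_apply hy
      convert! (((hd0 y).sub_const (f x)).sub (A.hasFDerivAt.comp y hy)).sub
        (hBy.const_smul (1 / 2 : ℝ)) using 1
      ext w
      have := hsymm w (y - x)
      simp only [← hB] at this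
      simp at this ⊢
      rw [this, ← add_smul]
      norm_num)
    (by simp) (fun y => h1 y) (x + v)
  simpa using h0

end Taylor

lemma abs_norm_sq_sub_second_order_le {E F : Type*} [NormedAddCommGroup E] [NormedSpace ℝ E]
    [NormedAddCommGroup F] [InnerProductSpace ℝ F] {f : E → F} (hf : ContDiff ℝ 3 f)
    (hC : ∃ C, ∀ y, ‖iteratedFDeriv ℝ 3 f y‖ ≤ C) (x : E) (c : F) :
    ∃ K, 0 ≤ K ∧ ∀ v, |‖f (x + v) - c‖ ^ 2 - (‖f x - c‖ ^ 2
      + 2 * inner ℝ (f x - c) (fderiv ℝ f x v)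
      + (inner ℝ (f x - c) (fderiv ℝ (fderiv ℝ f) x v v)
        + inner ℝ (fderiv ℝ f x v) (fderiv ℝ f x v)))| ≤ K * (‖v‖ ^ 3 * (1 + ‖v‖) ^ 3) := by
  obtain ⟨C, hC⟩ := hC
  have hC0 : 0 ≤ C := (norm_nonneg _).trans (hC x)
  have hrem := norm_second_order_taylor_remainder_le hf hC x
  set A := fderiv ℝ f x
  set B := fderiv ℝ (fderiv ℝ f) x
  set a := f x - c
  refine ⟨‖A‖ * ‖B‖ + ‖B‖ ^ 2 + 2 * (‖a‖ + ‖A‖ + ‖B‖) * C + C ^ 2, by positivity, fun v => ?_⟩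
  set R := f (x + v) - f x - A v - (1 / 2 : ℝ) • B v v with hR
  have hAv : ‖A v‖ ≤ ‖A‖ * ‖v‖ := A.le_opNorm v
  have hBv : ‖B v v‖ ≤ ‖B‖ * ‖v‖ ^ 2 := by
    simpa [pow_two, mul_assoc] using B.le_opNorm₂ v v
  have hRv : ‖R‖ ≤ C * ‖v‖ ^ 3 := hrem v
  have hsum : f (x + v) - c = a + A v + (1 / 2 : ℝ) • B v v + R := by simp only [hR, a]; abel
  have hexp : ‖f (x + v) - c‖ ^ 2 - (‖a‖ ^ 2 + 2 * inner ℝ a (A v)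
      + (inner ℝ a (B v v) + inner ℝ (A v) (A v)))
      = inner ℝ (A v) (B v v) + 1 / 4 * inner ℝ (B v v) (B v v) + 2 * inner ℝ a R
        + 2 * inner ℝ (A v) R + inner ℝ (B v v) R + inner ℝ R R := by
    rw [hsum, ← real_inner_self_eq_norm_sq, ← real_inner_self_eq_norm_sq]
    simp only [inner_add_left, inner_add_right, real_inner_smul_left, real_inner_smul_right]
    rw [real_inner_comm (A v) a, real_inner_comm (B v v) a, real_inner_comm R a,
      real_inner_comm (B v v) (A v), real_inner_comm R (A v), real_inner_comm R (B v v)]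
    ring
  rw [hexp]
  set t := ‖v‖
  have ht : 0 ≤ t := norm_nonneg v
  have b1 : |inner ℝ (A v) (B v v)| ≤ (‖A‖ * t) * (‖B‖ * t ^ 2) :=
    (abs_real_inner_le_norm _ _).trans (by gcongr)
  have b2 : |inner ℝ (B v v) (B v v)| ≤ (‖B‖ * t ^ 2) * (‖B‖ * t ^ 2) :=
    (abs_real_inner_le_norm _ _).trans (by gcongr)
  have b3 : |inner ℝ a R| ≤ ‖a‖ * (C * t ^ 3) :=
    (abs_real_inner_le_norm _ _).trans (by gcongr)
  have b4 : |inner ℝ (A v) R| ≤ (‖A‖ * t) * (C * t ^ 3) :=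
    (abs_real_inner_le_norm _ _).trans (by gcongr)
  have b5 : |inner ℝ (B v v) R| ≤ (‖B‖ * t ^ 2) * (C * t ^ 3) :=
    (abs_real_inner_le_norm _ _).trans (by gcongr)
  have b6 : |inner ℝ R R| ≤ (C * t ^ 3) * (C * t ^ 3) :=
    (abs_real_inner_le_norm _ _).trans (by gcongr)
  have p0 : t ^ 3 ≤ t ^ 3 * (1 + t) ^ 3 :=
    le_mul_of_one_le_right (by positivity) (one_le_pow₀ (by linarith))
  have p1 : t ^ 4 ≤ t ^ 3 * (1 + t) ^ 3 := by
    have : t ^ 4 = t ^ 3 * t := by ring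
    rw [this]; gcongr; nlinarith [pow_nonneg ht 2, pow_nonneg ht 3]
  have p2 : t ^ 5 ≤ t ^ 3 * (1 + t) ^ 3 := by
    have : t ^ 5 = t ^ 3 * t ^ 2 := by ring
    rw [this]; gcongr; nlinarith [pow_nonneg ht 2, pow_nonneg ht 3]
  have p3 : t ^ 6 ≤ t ^ 3 * (1 + t) ^ 3 := by
    have : t ^ 6 = t ^ 3 * t ^ 3 := by ring
    rw [this]; gcongr; linarith
  set T := t ^ 3 * (1 + t) ^ 3
  have hT : 0 ≤ T := by positivity
  have q1 := mul_le_mul_of_nonneg_left p0 (show 0 ≤ ‖A‖ * ‖B‖ by positivity)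
  have q2 := mul_le_mul_of_nonneg_left p1 (show 0 ≤ ‖B‖ ^ 2 by positivity)
  have q3 := mul_le_mul_of_nonneg_left p0 (show 0 ≤ ‖a‖ * C by positivity)
  have q4 := mul_le_mul_of_nonneg_left p1 (show 0 ≤ ‖A‖ * C by positivity)
  have q5 := mul_le_mul_of_nonneg_left p2 (show 0 ≤ ‖B‖ * C by positivity)
  have q6 := mul_le_mul_of_nonneg_left p3 (show 0 ≤ C ^ 2 by positivity)
  have q7 : 0 ≤ ‖B‖ * C * T := by positivity
  have q8 : 0 ≤ ‖B‖ ^ 2 * T := by positivity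
  rw [abs_le] at b1 b2 b3 b4 b5 b6 ⊢
  constructor <;> linarith


lemma withDensity_gaussian_eq_map_stdGaussian {L : ℕ} {σ : ℝ} (hσ : 0 < σ) :
    (volume : Measure (EuclideanSpace ℝ (Fin L))).withDensity (fun u => ENNReal.ofReal
      ((2 * Real.pi * σ ^ 2) ^ (-(L : ℝ) / 2) * Real.exp (-‖u‖ ^ 2 / (2 * σ ^ 2))))
      = (stdGaussian (EuclideanSpace ℝ (Fin L))).map (fun u => σ • u) := by
  set b : ℝ := 1 / (2 * σ ^ 2) with hb
  have hb0 : 0 < b := by positivity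
  have hbre : 0 < (b : ℂ).re := by simpa using hb0
  set κ : ℝ := (2 * Real.pi * σ ^ 2) ^ (-(L : ℝ) / 2) with hκ
  have hint : Integrable (fun u : EuclideanSpace ℝ (Fin L) =>
      κ * Real.exp (-‖u‖ ^ 2 / (2 * σ ^ 2))) := by
    have h := (GaussianFourier.integrable_cexp_neg_mul_sq_norm_add hbre 0
      (0 : EuclideanSpace ℝ (Fin L))).re
    refine (h.congr (ae_of_all _ fun u => ?_)).const_mul κ
    have : (-(b : ℂ) * (‖u‖ : ℂ) ^ 2 + 0 * (inner ℝ (0 : EuclideanSpace ℝ (Fin L)) u : ℂ))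
        = ((-‖u‖ ^ 2 / (2 * σ ^ 2) : ℝ) : ℂ) := by
      rw [hb]; push_cast; ring
    simp only [this]
    exact Complex.exp_ofReal_re _
  have := isFiniteMeasure_withDensity_ofReal hint.2
  have : IsProbabilityMeasure
      ((stdGaussian (EuclideanSpace ℝ (Fin L))).map (fun u => σ • u)) :=
    Measure.isProbabilityMeasure_map (by fun_prop)
  apply Measure.ext_of_charFun
  ext t
  rw [charFun_map_smul, charFun_stdGaussian, charFun_apply,
    integral_withDensity_eq_integral_toReal_smul (by fun_prop) (by simp)]
  have hpt (u : EuclideanSpace ℝ (Fin L)) :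
      (ENNReal.ofReal (κ * Real.exp (-‖u‖ ^ 2 / (2 * σ ^ 2)))).toReal •
        Complex.exp (((inner ℝ u t : ℝ) : ℂ) * Complex.I)
      = (κ : ℂ) * Complex.exp (-(b : ℂ) * (‖u‖ : ℂ) ^ 2 + Complex.I * (inner ℝ t u : ℝ)) := by
    rw [ENNReal.toReal_ofReal (by positivity), Complex.real_smul, Complex.ofReal_mul,
      Complex.ofReal_exp, mul_assoc, ← Complex.exp_add, real_inner_comm t u, hb]
    congr 2
    push_cast
    ring
  simp_rw [hpt]
  rw [integral_const_mul, GaussianFourier.integral_cexp_neg_mul_sq_norm_add hbre, ← mul_assoc]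
  have hconst : (κ : ℂ) * ((Real.pi : ℂ) / b) ^
      ((Module.finrank ℝ (EuclideanSpace ℝ (Fin L)) : ℂ) / 2) = 1 := by
    have h1 : (Real.pi : ℂ) / b = ((2 * Real.pi * σ ^ 2 : ℝ) : ℂ) := by
      rw [hb]; push_cast
      have : (σ : ℂ) ≠ 0 := by exact_mod_cast hσ.ne'
      field_simp
    have h2 : ((Module.finrank ℝ (EuclideanSpace ℝ (Fin L)) : ℂ) / 2) = ((L / 2 : ℝ) : ℂ) := by
      simp
    rw [h1, h2, ← Complex.ofReal_cpow (by positivity), ← Complex.ofReal_mul, hκ,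
      ← Real.rpow_add (by positivity), show -(L : ℝ) / 2 + L / 2 = 0 by ring]
    simp
  rw [hconst, one_mul, norm_smul, hb, Complex.I_sq]
  congr 1
  have : (σ : ℂ) ≠ 0 := by exact_mod_cast hσ.ne'
  simp only [Real.norm_eq_abs, abs_of_pos hσ]
  push_cast
  field_simp
  norm_num

lemma integral_mul_gaussian_density {L : ℕ} {σ : ℝ} (hσ : 0 < σ)
    (F : EuclideanSpace ℝ (Fin L) → ℝ) :
    ∫ u, F u * ((2 * Real.pi * σ ^ 2) ^ (-(L : ℝ) / 2) * Real.exp (-‖u‖ ^ 2 / (2 * σ ^ 2)))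
      = ∫ u, F (σ • u) ∂(stdGaussian (EuclideanSpace ℝ (Fin L))) := by
  have hemb : MeasurableEmbedding (fun u : EuclideanSpace ℝ (Fin L) => σ • u) :=
    (Homeomorph.smulOfNeZero σ hσ.ne').measurableEmbedding
  rw [← hemb.integral_map, ← withDensity_gaussian_eq_map_stdGaussian hσ,
    integral_withDensity_eq_integral_toReal_smul (by fun_prop) (by simp)]
  refine integral_congr_ae (ae_of_all _ fun u => ?_)
  simp only [smul_eq_mul]
  rw [ENNReal.toReal_ofReal (by positivity), mul_comm]

lemma integrable_norm_pow_stdGaussian {E : Type*} [NormedAddCommGroup E] [InnerProductSpace ℝ E]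
    [FiniteDimensional ℝ E] [MeasurableSpace E] [BorelSpace E] (n : ℕ) :
    Integrable (fun u => ‖u‖ ^ n) (stdGaussian E) := by
  have : CompleteSpace E := FiniteDimensional.complete ℝ E
  rcases eq_or_ne n 0 with rfl | hn
  · simp
  · exact (IsGaussian.memLp_id (stdGaussian E) n (by simp)).integrable_norm_pow hn

lemma integral_apply_mul_apply_stdGaussian {L : ℕ} (i j : Fin L) :
    ∫ u, u i * u j ∂(stdGaussian (EuclideanSpace ℝ (Fin L))) = if i = j then 1 else 0 := by
  have hmem (k : Fin L) : MemLp (fun u : EuclideanSpace ℝ (Fin L) => u k) 2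
      (stdGaussian (EuclideanSpace ℝ (Fin L))) :=
    IsGaussian.memLp_dual _ (EuclideanSpace.proj k : EuclideanSpace ℝ (Fin L) →L[ℝ] ℝ) 2 (by simp)
  have hmean (k : Fin L) : ∫ u, u k ∂(stdGaussian (EuclideanSpace ℝ (Fin L))) = 0 :=
    integral_strongDual_stdGaussian (EuclideanSpace.proj k : EuclideanSpace ℝ (Fin L) →L[ℝ] ℝ)
  have h := covariance_eval_multivariateGaussian (μ := 0) (Matrix.PosSemidef.one (R := ℝ)) i j
  rw [multivariateGaussian_zero_one, covariance_eq_sub (hmem i) (hmem j), hmean, hmean] at h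
  simpa [Matrix.one_apply] using h

lemma integrable_bilin_stdGaussian {E : Type*} [NormedAddCommGroup E] [InnerProductSpace ℝ E]
    [FiniteDimensional ℝ E] [MeasurableSpace E] [BorelSpace E] (Q : E →L[ℝ] E →L[ℝ] ℝ) :
    Integrable (fun u => Q u u) (stdGaussian E) := by
  refine ((integrable_norm_pow_stdGaussian 2).const_mul ‖Q‖).mono'
    (Continuous.aestronglyMeasurable (by fun_prop)) (ae_of_all _ fun u => ?_)
  simpa [pow_two, mul_assoc] using Q.le_opNorm₂ u u

lemma integral_bilin_stdGaussian {L : ℕ}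
    (Q : EuclideanSpace ℝ (Fin L) →L[ℝ] EuclideanSpace ℝ (Fin L) →L[ℝ] ℝ) :
    ∫ u, Q u u ∂(stdGaussian (EuclideanSpace ℝ (Fin L)))
      = ∑ i, Q (EuclideanSpace.single i 1) (EuclideanSpace.single i 1) := by
  have hexp (u : EuclideanSpace ℝ (Fin L)) : Q u u = ∑ i, ∑ j,
      (u i * u j) * Q (EuclideanSpace.single i 1) (EuclideanSpace.single j 1) := by
    have hu : u = ∑ i, u i • EuclideanSpace.single i (1 : ℝ) := by
      simpa using ((EuclideanSpace.basisFun (Fin L) ℝ).sum_repr u).symm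
    conv_lhs => rw [hu]
    simp only [map_sum, map_smul, sum_apply, smul_apply,
      smul_eq_mul, Finset.mul_sum]
    rw [Finset.sum_comm]
    exact Finset.sum_congr rfl fun i _ => Finset.sum_congr rfl fun j _ => by ring
  have hint (i j : Fin L) : Integrable (fun u : EuclideanSpace ℝ (Fin L) => u i * u j)
      (stdGaussian (EuclideanSpace ℝ (Fin L))) := by
    refine (integrable_norm_pow_stdGaussian 2).mono'
      (Continuous.aestronglyMeasurable (by fun_prop)) (ae_of_all _ fun u => ?_)
    rw [norm_mul, pow_two]
    gcongr <;> exact PiLp.norm_apply_le u _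
  simp_rw [hexp]
  rw [integral_finsetSum _ fun i _ => integrable_finsetSum _ fun j _ => (hint i j).mul_const _]
  refine Finset.sum_congr rfl fun i _ => ?_
  rw [integral_finsetSum _ fun j _ => (hint i j).mul_const _]
  simp [integral_mul_const, integral_apply_mul_apply_stdGaussian]

lemma sq_norm_gradient_eq_sum {L : ℕ} (f : EuclideanSpace ℝ (Fin L) → ℝ)
    (x : EuclideanSpace ℝ (Fin L)) :
    ‖gradient f x‖ ^ 2 = ∑ i, fderiv ℝ f x (EuclideanSpace.single i 1) ^ 2 := by
  rw [EuclideanSpace.real_norm_sq_eq]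
  refine Finset.sum_congr rfl fun i _ => ?_
  have h : inner ℝ (gradient f x) (EuclideanSpace.single i (1 : ℝ))
      = fderiv ℝ f x (EuclideanSpace.single i 1) := by
    simp only [gradient, InnerProductSpace.toDual_symm_apply]
  rw [← h, EuclideanSpace.inner_single_right]
  simp

lemma fderiv_euclidean_apply {L : ℕ} {E : Type*} [NormedAddCommGroup E] [NormedSpace ℝ E]
    {f : E → EuclideanSpace ℝ (Fin L)} {y : E} (hf : DifferentiableAt ℝ f y) (l : Fin L) (v : E) :
    fderiv ℝ (fun z => f z l) y v = fderiv ℝ f y v l := by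
  have h := ((EuclideanSpace.proj l : EuclideanSpace ℝ (Fin L) →L[ℝ] ℝ).hasFDerivAt.comp y
    hf.hasFDerivAt).fderiv
  exact DFunLike.congr_fun h v

lemma fderiv_fderiv_euclidean_apply {L : ℕ} {E : Type*} [NormedAddCommGroup E] [NormedSpace ℝ E]
    {f : E → EuclideanSpace ℝ (Fin L)} (hf : ContDiff ℝ 2 f) (x : E) (l : Fin L) (v w : E) :
    fderiv ℝ (fun y => fderiv ℝ (fun z => f z l) y v) x w
      = fderiv ℝ (fderiv ℝ f) x w v l := by
  have hd : Differentiable ℝ f := hf.differentiable (by norm_num)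
  have hd1 : Differentiable ℝ (fderiv ℝ f) :=
    (hf.fderiv_right (m := 1) (by norm_num)).differentiable (by norm_num)
  simp_rw [fun y => fderiv_euclidean_apply (hd y) l v]
  rw [fderiv_euclidean_apply (f := fun y => fderiv ℝ f y v)
    ((hd1 x).clm_apply (differentiableAt_const v))]
  rw [((hd1 x).hasFDerivAt.clm_apply (hasFDerivAt_const v x)).fderiv]
  simp

/-- The quadratic term of `v ↦ ‖f (x + v) - c‖ ^ 2` when `a = f x - c`, `A` is the derivative of `f`
at `x` and `B` is its second derivative. -/
noncomputable def sqNormQuadraticTerm {E F : Type*} [NormedAddCommGroup E] [NormedSpace ℝ E]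
    [NormedAddCommGroup F] [InnerProductSpace ℝ F] (a : F) (A : E →L[ℝ] F)
    (B : E →L[ℝ] E →L[ℝ] F) : E →L[ℝ] E →L[ℝ] ℝ :=
  (ContinuousLinearMap.compL ℝ E F ℝ (innerSL ℝ a)).comp B +
    (isBoundedBilinearMap_inner (𝕜 := ℝ) (E := F)).toContinuousLinearMap.bilinearComp A A

lemma sqNormQuadraticTerm_apply {E F : Type*} [NormedAddCommGroup E] [NormedSpace ℝ E]
    [NormedAddCommGroup F] [InnerProductSpace ℝ F] (a : F) (A : E →L[ℝ] F)
    (B : E →L[ℝ] E →L[ℝ] F) (v w : E) :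
    sqNormQuadraticTerm a A B v w = inner ℝ a (B v w) + inner ℝ (A v) (A w) := by
  simp [sqNormQuadraticTerm]

/-- **Second-order expansion of the Gaussian-corrupted reconstruction error (Eq. (15)).**
For `r : ℝ^L → ℝ^L` three times continuously differentiable with globally bounded third
derivatives, and `ν ∼ N(0, σ² I_L)` (with density `φ σ`), as `σ → 0`,
`E_ν ‖r(x+ν) - x‖² = ‖r(x) - x‖² + σ² ∑ₗ [(rₗ(x) - xₗ) Δrₗ(x) + ‖∇rₗ(x)‖²] + O(σ³)`,
where `Δrₗ` is the trace of the Hessian of the `l`-th component of `r`. -/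
theorem dae_objective_second_order_expansion (L : ℕ)
    (r : EuclideanSpace ℝ (Fin L) → EuclideanSpace ℝ (Fin L))
    (hr : ContDiff ℝ 3 r)
    (hr3_bdd : ∃ C, ∀ y, ‖iteratedFDeriv ℝ 3 r y‖ ≤ C)
    (x : EuclideanSpace ℝ (Fin L))
    (φ : ℝ → EuclideanSpace ℝ (Fin L) → ℝ)
    (hφ : ∀ σ u, φ σ u =
      (2 * Real.pi * σ ^ 2) ^ (-(L : ℝ) / 2) * Real.exp (-‖u‖ ^ 2 / (2 * σ ^ 2))) :
    (fun σ : ℝ =>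
        (∫ ν, ‖r (x + ν) - x‖ ^ 2 * φ σ ν) -
          (‖r x - x‖ ^ 2 + σ ^ 2 * ∑ l, ((r x l - x l) *
              (∑ i, fderiv ℝ (fun y => fderiv ℝ (fun z => r z l) y
                  (EuclideanSpace.single i (1 : ℝ))) x (EuclideanSpace.single i (1 : ℝ)))
            + ‖gradient (fun y => r y l) x‖ ^ 2)))
      =O[𝓝[>] (0 : ℝ)] fun σ => σ ^ 3 := by
  obtain ⟨K, hK0, hK⟩ := abs_norm_sq_sub_second_order_le hr hr3_bdd x x
  set μ := stdGaussian (EuclideanSpace ℝ (Fin L))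
  set A := fderiv ℝ r x
  set B := fderiv ℝ (fderiv ℝ r) x
  have htrace : ∑ l, ((r x l - x l) * (∑ i, fderiv ℝ (fun y => fderiv ℝ (fun z => r z l) y
        (EuclideanSpace.single i (1 : ℝ))) x (EuclideanSpace.single i (1 : ℝ)))
        + ‖gradient (fun y => r y l) x‖ ^ 2)
      = ∑ i, sqNormQuadraticTerm (r x - x) A B (EuclideanSpace.single i 1)
          (EuclideanSpace.single i 1) := by
    simp_rw [fderiv_fderiv_euclidean_apply (hr.of_le (by norm_num)), sq_norm_gradient_eq_sum,
      fderiv_euclidean_apply (hr.differentiable (by norm_num) x), sqNormQuadraticTerm_apply,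
      PiLp.inner_apply, Finset.mul_sum, ← Finset.sum_add_distrib]
    rw [Finset.sum_comm]
    refine Finset.sum_congr rfl fun i _ => Finset.sum_congr rfl fun l _ => ?_
    simp only [RCLike.inner_apply, conj_trivial, PiLp.sub_apply]
    ring
  rw [htrace, ← integral_bilin_stdGaussian]
  set Q := sqNormQuadraticTerm (r x - x) A B with hQ
  have hmom : Integrable (fun u => ‖u‖ ^ 3 * (1 + ‖u‖) ^ 3) μ := by
    have h := (((integrable_norm_pow_stdGaussian (E := EuclideanSpace ℝ (Fin L)) 3).add
      ((integrable_norm_pow_stdGaussian 4).const_mul 3)).add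
      ((integrable_norm_pow_stdGaussian 5).const_mul 3)).add (integrable_norm_pow_stdGaussian 6)
    refine h.congr (ae_of_all _ fun u => ?_)
    simp only [Pi.add_apply]
    ring
  refine IsBigO.of_bound (K * ∫ u, ‖u‖ ^ 3 * (1 + ‖u‖) ^ 3 ∂μ) ?_
  filter_upwards [Ioc_mem_nhdsGT (zero_lt_one' ℝ)] with σ ⟨hσ0, hσ1⟩
  simp_rw [hφ]
  rw [integral_mul_gaussian_density hσ0]
  set p : EuclideanSpace ℝ (Fin L) → ℝ := fun u =>
    ‖r x - x‖ ^ 2 + 2 * σ * innerSL ℝ (r x - x) (A u) + σ ^ 2 * Q u u with hp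
  set rem : EuclideanSpace ℝ (Fin L) → ℝ := fun u => ‖r (x + σ • u) - x‖ ^ 2 - p u with hrem
  have hlin : Integrable (fun u => innerSL ℝ (r x - x) (A u)) μ :=
    ((innerSL ℝ (r x - x)).comp A).integrable_comp
      (IsGaussian.integrable_id (μ := μ))
  have hlin0 : ∫ u, innerSL ℝ (r x - x) (A u) ∂μ = 0 :=
    integral_strongDual_stdGaussian ((innerSL ℝ (r x - x)).comp A)
  have hQint : Integrable (fun u => Q u u) μ := integrable_bilin_stdGaussian Q
  have hpint : Integrable p μ :=
    ((integrable_const _).add (hlin.const_mul _)).add (hQint.const_mul _)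
  have hpval : ∫ u, p u ∂μ = ‖r x - x‖ ^ 2 + σ ^ 2 * ∫ u, Q u u ∂μ := by
    have hadd := integral_add ((integrable_const (‖r x - x‖ ^ 2)).add (hlin.const_mul (2 * σ)))
      (hQint.const_mul (σ ^ 2))
    simp only [Pi.add_apply] at hadd
    rw [hp, hadd, integral_add (integrable_const _) (hlin.const_mul _), integral_const_mul,
      integral_const_mul, hlin0]
    simp
  have hbound (u : EuclideanSpace ℝ (Fin L)) :
      ‖rem u‖ ≤ K * σ ^ 3 * (‖u‖ ^ 3 * (1 + ‖u‖) ^ 3) := by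
    have h := hK (σ • u)
    have hval : rem u = ‖r (x + σ • u) - x‖ ^ 2 - (‖r x - x‖ ^ 2
        + 2 * inner ℝ (r x - x) (A (σ • u)) + (inner ℝ (r x - x) (B (σ • u) (σ • u))
        + inner ℝ (A (σ • u)) (A (σ • u)))) := by
      simp only [hrem, hp, hQ, sqNormQuadraticTerm_apply, map_smul, smul_apply,
        innerSL_apply_apply, real_inner_smul_left, real_inner_smul_right]
      ring
    rw [Real.norm_eq_abs, hval]
    refine h.trans ?_
    rw [norm_smul, Real.norm_eq_abs, abs_of_pos hσ0, mul_pow]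
    have hle : σ * ‖u‖ ≤ ‖u‖ := mul_le_of_le_one_left (norm_nonneg u) hσ1
    calc K * (σ ^ 3 * ‖u‖ ^ 3 * (1 + σ * ‖u‖) ^ 3)
        ≤ K * (σ ^ 3 * ‖u‖ ^ 3 * (1 + ‖u‖) ^ 3) := by gcongr
      _ = _ := by ring
  have hcont : Continuous rem := by
    have := hr.continuous
    fun_prop
  have hremint : Integrable rem μ :=
    (hmom.const_mul _).mono' hcont.aestronglyMeasurable (ae_of_all _ hbound)
  have hsplit : ∫ u, ‖r (x + σ • u) - x‖ ^ 2 ∂μ = ∫ u, rem u ∂μ + ∫ u, p u ∂μ := by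
    rw [← integral_add hremint hpint]
    simp [hrem]
  rw [hsplit, hpval, add_sub_cancel_right]
  calc ‖∫ u, rem u ∂μ‖ ≤ ∫ u, K * σ ^ 3 * (‖u‖ ^ 3 * (1 + ‖u‖) ^ 3) ∂μ :=
        norm_integral_le_of_norm_le (hmom.const_mul _) (ae_of_all _ hbound)
    _ = K * (∫ u, ‖u‖ ^ 3 * (1 + ‖u‖) ^ 3 ∂μ) * ‖σ ^ 3‖ := by
        rw [integral_const_mul, Real.norm_of_nonneg (by positivity)]
        ring
end
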